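/- Let r : ℝ → (0,∞) be a 2π-periodic continuously differentiable positive function and let f(t) = r(t)·e^{it}. Then sup_{e^{it} ≠ e^{is}} |f(t) − f(s)|/|e^{it} − e^{is}| = max_{t ∈ [0,2π]} √(r(t)² + r'(t)²). -/

import Mathlib

open Set Filter Complex

/-- The squared chord between two points given in polar coordinates. -/
lemma sq_norm_polar_sub (a b t s : ℝ) :
    ‖(a : ℂ) * Complex.exp (t * Complex.I) - (b : ℂ) * Complex.exp (s * Complex.I)‖ ^ 2 =
      (a - b) ^ 2 + 4 * a * b * Real.sin ((t - s) / 2) ^ 2 := by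
  have h : Real.sin ((t - s) / 2) ^ 2 = (1 - Real.cos (t - s)) / 2 := by
    rw [Real.sin_sq_eq_half_sub, mul_div_cancel₀ _ two_ne_zero]
    ring
  rw [h, Real.cos_sub, Complex.sq_norm, Complex.normSq_apply]
  simp only [Complex.sub_re, Complex.sub_im, Complex.re_ofReal_mul, Complex.im_ofReal_mul,
    Complex.exp_ofReal_mul_I_re, Complex.exp_ofReal_mul_I_im]
  linear_combination a ^ 2 * Real.sin_sq_add_cos_sq t + b ^ 2 * Real.sin_sq_add_cos_sq s

/-- The squared chord between two points of the unit circle. -/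
lemma sq_norm_exp_sub (t s : ℝ) :
    ‖Complex.exp (t * Complex.I) - Complex.exp (s * Complex.I)‖ ^ 2 =
      4 * Real.sin ((t - s) / 2) ^ 2 := by
  simpa using sq_norm_polar_sub 1 1 t s

lemma sq_cos_sub_cos_add_le {a b θ : ℝ} (hab : |a - b| ≤ 2 * θ) (hθ : θ ≤ Real.pi / 2) :
    (Real.cos a - Real.cos b) ^ 2 + 4 * Real.cos a * Real.cos b * Real.sin θ ^ 2 ≤
      4 * Real.sin θ ^ 2 := by
  obtain ⟨u, v, rfl, rfl⟩ : ∃ u v, a = u + v ∧ b = u - v :=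
    ⟨(a + b) / 2, (a - b) / 2, by ring, by ring⟩
  have hv : |v| ≤ θ := by
    rw [show u + v - (u - v) = 2 * v by ring, abs_mul, abs_two] at hab
    linarith
  have hsin : Real.sin v ^ 2 ≤ Real.sin θ ^ 2 := by
    obtain ⟨h₁, h₂⟩ := abs_le.mp hv
    apply sq_le_sq'
    · rw [← Real.sin_neg]
      exact Real.sin_le_sin_of_le_of_le_pi_div_two (by linarith) (by linarith) h₁
    · exact Real.sin_le_sin_of_le_of_le_pi_div_two (by linarith) hθ h₂
  have hu := Real.sin_sq_add_cos_sq u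
  have hc := Real.sin_sq_add_cos_sq v
  rw [Real.cos_add, Real.cos_sub]
  have h₁ : Real.cos u ^ 2 = 1 - Real.sin u ^ 2 := by linarith
  have h₂ : Real.cos v ^ 2 = 1 - Real.sin v ^ 2 := by linarith
  have hexp : 4 * (Real.cos u * Real.cos v - Real.sin u * Real.sin v) *
      (Real.cos u * Real.cos v + Real.sin u * Real.sin v) =
        4 * (1 - Real.sin u ^ 2 - Real.sin v ^ 2) := by
    linear_combination 4 * Real.cos v ^ 2 * h₁ + 4 * (1 - Real.sin u ^ 2) * h₂
  rw [hexp]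
  nlinarith [mul_le_mul_of_nonneg_left hsin (sq_nonneg (Real.sin u)),
    mul_nonneg (sq_nonneg (Real.sin v)) (sq_nonneg (Real.sin θ))]

lemma abs_arccos_div_sub_le {r : ℝ → ℝ} (hr : Differentiable ℝ r) {M : ℝ} (hM : 0 < M)
    (hbd : ∀ t, r t ^ 2 + deriv r t ^ 2 < M ^ 2) (t s : ℝ) :
    |Real.arccos (r t / M) - Real.arccos (r s / M)| ≤ |t - s| := by
  have hlt : ∀ x, (r x / M) ^ 2 < 1 := fun x ↦ by
    rw [div_pow, div_lt_one (by positivity)]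
    nlinarith [hbd x, sq_nonneg (deriv r x)]
  have hder : ∀ x, HasDerivAt (fun y ↦ Real.arccos (r y / M))
      (-(1 / √(1 - (r x / M) ^ 2)) * (deriv r x / M)) x := fun x ↦ by
    have hx := abs_lt.mp ((sq_lt_one_iff_abs_lt_one _).mp (hlt x))
    exact HasDerivAt.comp (h₂ := Real.arccos) x (Real.hasDerivAt_arccos hx.1.ne' hx.2.ne)
      ((hr x).hasDerivAt.div_const M)
  have hle : ∀ x ∈ (univ : Set ℝ),
      ‖-(1 / √(1 - (r x / M) ^ 2)) * (deriv r x / M)‖ ≤ 1 := fun x _ ↦ by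
    have hpos : 0 < √(1 - (r x / M) ^ 2) := Real.sqrt_pos.mpr (by linarith [hlt x])
    rw [norm_mul, norm_neg, Real.norm_eq_abs, Real.norm_eq_abs, abs_of_pos (by positivity),
      one_div_mul_eq_div, div_le_one hpos]
    apply Real.abs_le_sqrt
    rw [le_sub_iff_add_le, div_pow, div_pow, ← add_div, div_le_one (by positivity)]
    linarith [hbd x]
  simpa using convex_univ.norm_image_sub_le_of_norm_hasDerivWithin_le
    (fun x _ ↦ (hder x).hasDerivWithinAt) hle (mem_univ s) (mem_univ t)

lemma norm_polar_sub_le_of_lt {r : ℝ → ℝ} (hr : Differentiable ℝ r) {M : ℝ} (hM : 0 < M)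
    (hbd : ∀ t, r t ^ 2 + deriv r t ^ 2 < M ^ 2) {t s : ℝ} (hts : |t - s| ≤ Real.pi) :
    ‖(r t : ℂ) * Complex.exp (t * Complex.I) - (r s : ℂ) * Complex.exp (s * Complex.I)‖ ≤
      M * ‖Complex.exp (t * Complex.I) - Complex.exp (s * Complex.I)‖ := by
  refine (sq_le_sq₀ (by positivity) (by positivity)).mp ?_
  rw [mul_pow, sq_norm_polar_sub, sq_norm_exp_sub]
  have hcos : ∀ x, r x = M * Real.cos (Real.arccos (r x / M)) := fun x ↦ by
    have hx : |r x| ≤ M := (abs_lt_of_sq_lt_sq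
      (by nlinarith [hbd x, sq_nonneg (deriv r x)]) hM.le).le
    obtain ⟨h₁, h₂⟩ := abs_le.mp hx
    rw [Real.cos_arccos, mul_div_cancel₀ _ hM.ne']
    · rw [le_div_iff₀ hM]; linarith
    · rwa [div_le_one hM]
  have hsin : Real.sin ((t - s) / 2) ^ 2 = Real.sin (|t - s| / 2) ^ 2 := by
    rcases abs_choice (t - s) with h | h <;> rw [h]
    rw [neg_div, Real.sin_neg, neg_sq]
  have key := sq_cos_sub_cos_add_le (θ := |t - s| / 2)
    (by simpa [mul_div_cancel₀] using abs_arccos_div_sub_le hr hM hbd t s) (by linarith)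
  rw [hsin, hcos t, hcos s]
  nlinarith [mul_le_mul_of_nonneg_left key (sq_nonneg M)]

/-- A bound on the speed of a closed polar curve is a Lipschitz constant with respect to
chords of the unit circle. -/
lemma norm_polar_sub_le {r : ℝ → ℝ} (hr : Differentiable ℝ r)
    (hper : Function.Periodic r (2 * Real.pi)) {M : ℝ} (hM : 0 ≤ M)
    (hbd : ∀ t, r t ^ 2 + deriv r t ^ 2 ≤ M ^ 2) (t s : ℝ) :
    ‖(r t : ℂ) * Complex.exp (t * Complex.I) - (r s : ℂ) * Complex.exp (s * Complex.I)‖ ≤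
      M * ‖Complex.exp (t * Complex.I) - Complex.exp (s * Complex.I)‖ := by
  wlog hts : |t - s| ≤ Real.pi generalizing t
  · let n : ℤ := round ((t - s) / (2 * Real.pi))
    have hpi := Real.pi_pos
    have hn : |t - n * (2 * Real.pi) - s| ≤ Real.pi := by
      have h := abs_sub_round ((t - s) / (2 * Real.pi))
      have heq : t - n * (2 * Real.pi) - s = ((t - s) / (2 * Real.pi) - n) * (2 * Real.pi) := by
        field_simp
        ring
      rw [heq, abs_mul, abs_of_pos (by positivity : 0 < 2 * Real.pi)]
      nlinarith
    have hexp : Complex.exp ((t - n * (2 * Real.pi) : ℝ) * Complex.I) =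
        Complex.exp (t * Complex.I) := by
      rw [Complex.exp_eq_exp_iff_exists_int]
      exact ⟨-n, by push_cast; ring⟩
    simpa only [hexp, hper.sub_int_mul_eq] using this _ hn
  · have hlim : Tendsto (fun c : ℝ ↦
        c * ‖Complex.exp (t * Complex.I) - Complex.exp (s * Complex.I)‖) (nhdsWithin M (Ioi M))
        (nhds (M * ‖Complex.exp (t * Complex.I) - Complex.exp (s * Complex.I)‖)) :=
      (tendsto_id.mul_const _).mono_left nhdsWithin_le_nhds
    refine ge_of_tendsto hlim ?_
    filter_upwards [self_mem_nhdsWithin] with c (hc : M < c)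
    exact norm_polar_sub_le_of_lt hr (hM.trans_lt hc)
      (fun x ↦ (hbd x).trans_lt (pow_lt_pow_left₀ hc hM two_ne_zero)) hts

lemma lipschitzWith_exp_ofReal_mul_I :
    LipschitzWith 1 (fun t : ℝ ↦ Complex.exp (t * Complex.I)) := by
  refine LipschitzWith.of_dist_le_mul fun t s ↦ ?_
  rw [dist_eq_norm, Real.dist_eq, NNReal.coe_one, one_mul]
  refine (sq_le_sq₀ (by positivity) (abs_nonneg _)).mp ?_
  rw [sq_norm_exp_sub, sq_abs]
  have := sq_le_sq.mpr (Real.abs_sin_le_abs (x := (t - s) / 2))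
  nlinarith

lemma norm_deriv_polar {r : ℝ → ℝ} (hr : Differentiable ℝ r) (t : ℝ) :
    ‖deriv (fun x : ℝ ↦ (r x : ℂ) * Complex.exp (x * Complex.I)) t‖ =
      √(r t ^ 2 + deriv r t ^ 2) := by
  have h₁ : HasDerivAt (fun x : ℝ ↦ (r x : ℂ)) ((deriv r t : ℝ) : ℂ) t :=
    (hr t).hasDerivAt.ofReal_comp
  have h₂ : HasDerivAt (fun x : ℝ ↦ Complex.exp (x * Complex.I))
      (Complex.exp (t * Complex.I) * (1 * Complex.I)) t :=
    (((hasDerivAt_id (t : ℂ)).mul_const Complex.I).cexp).comp_ofReal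
  have h : deriv (fun x : ℝ ↦ (r x : ℂ) * Complex.exp (x * Complex.I)) t =
      (((deriv r t : ℝ) : ℂ) + r t * Complex.I) * Complex.exp (t * Complex.I) := by
    rw [(h₁.fun_mul h₂).deriv]
    ring
  rw [h, norm_mul, Complex.norm_exp_ofReal_mul_I, mul_one, Complex.norm_add_mul_I, add_comm]

/-- for a `2π`-periodic positive `C¹` function `r` and `f(t) = r(t)e^{it}`,
the chordal Lipschitz constant of the polar parametrization equals
`max_{t ∈ [0,2π]} √(r(t)² + r'(t)²)`. -/
theorem stmt8 (r : ℝ → ℝ) (hr : ContDiff ℝ 1 r) (hrpos : ∀ t, 0 < r t)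
    (hrper : Function.Periodic r (2 * Real.pi))
    (f : ℝ → ℂ) (hf : ∀ t, f t = (r t : ℂ) * Complex.exp (t * Complex.I)) :
    (⨆ t : ℝ, ⨆ s : ℝ,
        edist (f t) (f s) /
          edist (Complex.exp (t * Complex.I)) (Complex.exp (s * Complex.I))) =
      ⨆ t ∈ Icc (0 : ℝ) (2 * Real.pi),
        ENNReal.ofReal (Real.sqrt (r t ^ 2 + deriv r t ^ 2)) := by
  obtain rfl : f = fun t : ℝ ↦ (r t : ℂ) * Complex.exp (t * Complex.I) := funext hf
  have hd : Differentiable ℝ r := hr.differentiable one_ne_zero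
  have hdper : Function.Periodic (deriv r) (2 * Real.pi) := fun x ↦ by
    rw [← deriv_comp_add_const, funext hrper]
  apply le_antisymm
  · set L := ⨆ t ∈ Icc (0 : ℝ) (2 * Real.pi),
      ENNReal.ofReal (Real.sqrt (r t ^ 2 + deriv r t ^ 2))
    rcases eq_or_ne L ⊤ with htop | htop
    · rw [htop]
      exact le_top
    have hbd : ∀ t, r t ^ 2 + deriv r t ^ 2 ≤ L.toReal ^ 2 := fun t ↦ by
      obtain ⟨x, hx, hxt⟩ :=
        (show Function.Periodic (fun y ↦ r y ^ 2 + deriv r y ^ 2) (2 * Real.pi) from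
          fun y ↦ by simp only [hrper y, hdper y]).exists_mem_Ico₀ Real.two_pi_pos t
      have hle : ENNReal.ofReal (√(r x ^ 2 + deriv r x ^ 2)) ≤ L :=
        le_iSup₂ (f := fun t (_ : t ∈ Icc (0 : ℝ) (2 * Real.pi)) ↦
          ENNReal.ofReal (√(r t ^ 2 + deriv r t ^ 2))) x (Ico_subset_Icc_self hx)
      rw [ENNReal.ofReal_le_iff_le_toReal htop] at hle
      exact hxt.trans_le (Real.sqrt_le_iff.mp hle).2
    refine iSup₂_le fun t s ↦ ENNReal.div_le_of_le_mul ?_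
    rw [← ENNReal.ofReal_toReal htop, edist_dist, edist_dist,
      ← ENNReal.ofReal_mul ENNReal.toReal_nonneg, dist_eq_norm, dist_eq_norm]
    exact ENNReal.ofReal_le_ofReal
      (norm_polar_sub_le hd hrper ENNReal.toReal_nonneg hbd t s)
  · set K := ⨆ t : ℝ, ⨆ s : ℝ,
      edist ((r t : ℂ) * Complex.exp (t * Complex.I)) ((r s : ℂ) * Complex.exp (s * Complex.I)) /
        edist (Complex.exp (t * Complex.I)) (Complex.exp (s * Complex.I))
    refine iSup₂_le fun t _ ↦ ?_
    rcases eq_or_ne K ⊤ with htop | htop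
    · rw [htop]
      exact le_top
    have hlip : LipschitzWith K.toNNReal
        (fun t : ℝ ↦ (r t : ℂ) * Complex.exp (t * Complex.I)) := fun x y ↦ by
      rw [ENNReal.coe_toNNReal htop]
      have hexp : edist (Complex.exp (x * Complex.I)) (Complex.exp (y * Complex.I)) ≤
          edist x y := by
        simpa using lipschitzWith_exp_ofReal_mul_I x y
      rcases eq_or_ne (Complex.exp (x * Complex.I)) (Complex.exp (y * Complex.I)) with he | he
      · obtain ⟨n, hn⟩ := Complex.exp_eq_exp_iff_exists_int.mp he
        have hxy : x = y + n * (2 * Real.pi) := by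
          have h := congrArg Complex.im hn
          simpa using h
        have hrxy : r x = r y := by rw [hxy, hrper.int_mul n y]
        simp [he, hrxy]
      · refine le_trans ?_ (mul_le_mul_right hexp K)
        refine (ENNReal.div_le_iff (edist_pos.mpr he).ne' (edist_ne_top _ _)).mp ?_
        exact le_iSup₂ (f := fun t s : ℝ ↦
          edist ((r t : ℂ) * Complex.exp (t * Complex.I))
            ((r s : ℂ) * Complex.exp (s * Complex.I)) /
          edist (Complex.exp (t * Complex.I)) (Complex.exp (s * Complex.I))) x y
    have h := norm_deriv_le_of_lipschitz (x₀ := t) hlip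
    rw [norm_deriv_polar hd] at h
    exact (ENNReal.ofReal_le_iff_le_toReal htop).mpr h
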